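/- Let G be a finite group and R a ring such that every R-module has projective dimension at most n (R has global dimension ≤ n). If M is an R[G]-module of finite projective dimension over R[G], then M has projective dimension at most n over R[G]. -/

import Mathlib

open CategoryTheory

universe u

/-- `pdLE S n M` : the `S`-module `M` has projective dimension at most `n`,
expressed via the existence of a projective resolution of length `≤ n`
(built up one syzygy at a time). -/
def pdLE (S : Type u) [Ring S] : ℕ → ModuleCat.{u} S → Prop
  | 0, M => Module.Projective S M
  | n + 1, M =>
      ∃ (P K : ModuleCat.{u} S) (f : K ⟶ P) (g : P ⟶ M),
        Module.Projective S P ∧ Function.Injective f ∧ Function.Surjective g ∧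
        (∀ x, g (f x) = 0) ∧ (∀ y, g y = 0 → ∃ x, f x = y) ∧ pdLE S n K

namespace MonoidAlgebra

/-- The trace `w ↦ ∑ g, g • φ (g⁻¹ • w)` of an `R`-linear map between `R[G]`-modules. -/
noncomputable def groupTrace {R G V W : Type*} [Ring R] [Group G] [Fintype G]
    [AddCommGroup V] [Module R V] [Module R[G] V]
    [IsScalarTower R R[G] V]
    [AddCommGroup W] [Module R W] [Module R[G] W]
    [IsScalarTower R R[G] W]
    (φ : W →ₗ[R] V) : W →ₗ[R[G]] V where
  toFun w := ∑ g : G, single g (1 : R) • φ (single g⁻¹ (1 : R) • w)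
  map_add' x y := by simp [Finset.sum_add_distrib]
  map_smul' x w := by
    induction x using induction_linear with
    | zero => simp
    | add x y hx hy =>
      simp only [add_smul, smul_add, map_add, Finset.sum_add_distrib, RingHom.id_apply] at hx hy ⊢
      rw [hx, hy]
    | single h r =>
      simp only [RingHom.id_apply, Finset.smul_sum]
      refine Fintype.sum_bijective (h⁻¹ * ·) (Group.mulLeft_bijective h⁻¹) _ _ fun g ↦ ?_
      have key : single g⁻¹ (1 : R) * single h r = r • single (h⁻¹ * g)⁻¹ (1 : R) := by
        simp [single_mul_single]
      have key' : single g (1 : R) * r • (1 : R[G]) = single h r * single (h⁻¹ * g) (1 : R) := by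
        simp [one_def, single_mul_single]
      rw [smul_smul (single g⁻¹ (1 : R)), key, smul_assoc, map_smul, ← smul_one_smul R[G] r,
        smul_smul, key', mul_smul]

lemma groupTrace_apply {R G V W : Type*} [Ring R] [Group G] [Fintype G]
    [AddCommGroup V] [Module R V] [Module R[G] V]
    [IsScalarTower R R[G] V]
    [AddCommGroup W] [Module R W] [Module R[G] W]
    [IsScalarTower R R[G] W]
    (φ : W →ₗ[R] V) (w : W) :
    groupTrace (G := G) φ w = ∑ g : G, single g (1 : R) •
      φ (single g⁻¹ (1 : R) • w) := rfl

/-- Higman's criterion, forward direction: the identity of a projective `R[G]`-module is the trace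
of an `R`-linear endomorphism. -/
lemma exists_groupTrace_eq_id {R G P : Type*} [Ring R] [Group G] [Fintype G]
    [AddCommGroup P] [Module R P] [Module R[G] P]
    [IsScalarTower R R[G] P] [Module.Projective R[G] P] :
    ∃ θ : P →ₗ[R] P, groupTrace (G := G) θ = LinearMap.id := by
  obtain ⟨s, hs⟩ := Module.projective_def'.mp ‹Module.Projective R[G] P›
  let ε : R[G] →ₗ[R] R[G] :=
    lsingle 1 ∘ₗ Finsupp.lapply 1 ∘ₗ (coeffLinearEquiv R).toLinearMap
  have hε (x : R[G]) :
      ∑ g : G, single g (1 : R) * ε (single g⁻¹ (1 : R) * x) = x := by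
    have (g : G) : ε (single g⁻¹ (1 : R) * x) = single 1 (x.coeff g) := by
      change single 1 ((single g⁻¹ (1 : R) * x).coeff 1) = _
      simp
    simp only [this, single_mul_single, one_mul, mul_one]
    rw [← Finsupp.sum_fintype x.coeff (fun g r ↦ single g r) (by simp), sum_coeff_single]
  have hE (x : P →₀ R[G]) :
      ∑ g : G, single g (1 : R) • Finsupp.mapRange.linearMap ε (single g⁻¹ (1 : R) • x) = x := by
    ext1 p
    simpa [Finsupp.finsetSum_apply] using hε (x p)
  let l := Finsupp.linearCombination R[G] (id : P → P)
  refine ⟨l.restrictScalars R ∘ₗ Finsupp.mapRange.linearMap ε ∘ₗ s.restrictScalars R, ?_⟩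
  ext p
  simp only [groupTrace_apply, LinearMap.comp_apply, LinearMap.restrictScalars_apply,
    map_smul, LinearMap.id_apply]
  simp only [← map_smul l, ← map_sum l, hE]
  exact LinearMap.congr_fun hs p

/-- An injection of `R[G]`-modules with projective source that splits over `R` also splits over
`R[G]`. -/
lemma exists_leftInverse_of_projective {R G P W : Type*} [Ring R] [Group G]
    [Finite G] [AddCommGroup P] [Module R P] [Module R[G] P]
    [IsScalarTower R R[G] P] [Module.Projective R[G] P]
    [AddCommGroup W] [Module R W] [Module R[G] W]
    [IsScalarTower R R[G] W]
    (i : P →ₗ[R[G]] W) (r : W →ₗ[R] P) (hr : ∀ x, r (i x) = x) :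
    ∃ ρ : W →ₗ[R[G]] P, ρ ∘ₗ i = LinearMap.id := by
  cases nonempty_fintype G
  obtain ⟨θ, hθ⟩ := exists_groupTrace_eq_id (R := R) (G := G) (P := P)
  refine ⟨groupTrace (θ ∘ₗ r), ?_⟩
  rw [← hθ]
  ext x
  simp only [LinearMap.comp_apply, groupTrace_apply, ← map_smul, hr]

/-- A projective `R[G]`-module is projective over `R`. -/
lemma projective_restrictScalars {R G P : Type*} [Ring R] [Monoid G]
    [AddCommGroup P] [Module R P] [Module R[G] P]
    [IsScalarTower R R[G] P] [Module.Projective R[G] P] :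
    Module.Projective R P := by
  obtain ⟨s, hs⟩ := Module.projective_def'.mp ‹Module.Projective R[G] P›
  have : Module.Free R R[G] := .of_basis (basis G R)
  exact .of_split (s.restrictScalars R)
    ((Finsupp.linearCombination R[G] id).restrictScalars R)
    (LinearMap.ext fun x ↦ LinearMap.congr_fun hs x)

/-- Let `0 → K → P → M → 0` be an exact sequence of `R[G]`-modules with `K` and `P` projective over
`R[G]` and `G` finite. If `M` is projective over `R`, then it is projective over `R[G]`. -/
lemma projective_of_exact {R G K P M : Type*} [Ring R] [Group G] [Finite G]
    [AddCommGroup K] [Module R K] [Module R[G] K] [IsScalarTower R R[G] K]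
    [AddCommGroup P] [Module R P] [Module R[G] P] [IsScalarTower R R[G] P]
    [AddCommGroup M] [Module R M] [Module R[G] M] [IsScalarTower R R[G] M]
    [Module.Projective R[G] K] [Module.Projective R[G] P] [Module.Projective R M]
    {f : K →ₗ[R[G]] P} {g : P →ₗ[R[G]] M} (hf : Function.Injective f)
    (hg : Function.Surjective g) (hfg : Function.Exact f g) : Module.Projective R[G] M := by
  obtain ⟨s, hs⟩ := (g.restrictScalars R).exists_rightInverse_of_surjective
    (LinearMap.range_eq_top.mpr hg)
  have hfg' : Function.Exact (f.restrictScalars R) (g.restrictScalars R) := hfg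
  obtain ⟨r, hr⟩ := ((hfg'.split_tfae hf hg).out 0 1 :
    (∃ l, _ ∘ₗ l = LinearMap.id) ↔ ∃ l, l ∘ₗ _ = LinearMap.id).mp ⟨s, hs⟩
  obtain ⟨ρ, hρ⟩ := exists_leftInverse_of_projective f r (LinearMap.congr_fun hr)
  obtain ⟨σ, hσ⟩ := ((hfg.split_tfae hf hg).out 1 0 :
    (∃ l, l ∘ₗ _ = LinearMap.id) ↔ ∃ l, _ ∘ₗ l = LinearMap.id).mp ⟨ρ, hρ⟩
  exact .of_split σ g hσ

end MonoidAlgebra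

lemma pdLE_iff_hasProjectiveDimensionLE {S : Type u} [Ring S] {n : ℕ} {M : ModuleCat.{u} S} :
    pdLE S n M ↔ HasProjectiveDimensionLE M n := by
  induction n generalizing M with
  | zero => rw [← projective_iff_hasProjectiveDimensionLE_zero, ← IsProjective.iff_projective, pdLE]
  | succ n ih =>
    constructor
    · rintro ⟨P, K, f, g, hP, hf, hg, hfg, hex, hK⟩
      have hS : (ShortComplex.mk f g (by ext x; exact hfg x)).ShortExact :=
        { exact := (ShortComplex.moduleCat_exact_iff _).mpr hex
          mono_f := (ModuleCat.mono_iff_injective f).mpr hf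
          epi_g := (ModuleCat.epi_iff_surjective g).mpr hg }
      exact (hS.hasProjectiveDimensionLT_X₃_iff n ((IsProjective.iff_projective P).mp hP)).mpr
        (ih.mp hK)
    · intro hM
      have hS := M.shortExact_projectiveShortComplex
      refine ⟨_, _, M.projectiveShortComplex.f, M.projectiveShortComplex.g,
        (IsProjective.iff_projective _).mpr inferInstance,
        (ModuleCat.mono_iff_injective _).mp hS.mono_f,
        (ModuleCat.epi_iff_surjective _).mp hS.epi_g,
        fun x ↦ ConcreteCategory.congr_hom M.projectiveShortComplex.zero x,
        (ShortComplex.moduleCat_exact_iff _).mp hS.exact, ?_⟩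
      exact ih.mpr ((hS.hasProjectiveDimensionLT_X₃_iff n inferInstance).mp hM)

namespace MonoidAlgebra

variable {R G : Type u} [Ring R]

lemma isScalarTower_compHom [Monoid G] (M : Type*) [AddCommGroup M] [Module R[G] M] :
    letI := Module.compHom M (singleOneRingHom : R →+* R[G])
    IsScalarTower R R[G] M := by
  let := Module.compHom M (singleOneRingHom : R →+* R[G])
  refine ⟨fun r x m ↦ ?_⟩
  have h : (r • x : R[G]) = singleOneRingHom r * x := by
    ext a
    exact (coeff_single_one_mul x r a).symm
  rw [h]
  exact mul_smul (singleOneRingHom r) x m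

instance [Monoid G] (M : ModuleCat.{u} R[G]) :
    IsScalarTower R R[G] ((ModuleCat.restrictScalars singleOneRingHom).obj M) :=
  isScalarTower_compHom M

/-- Dimension shifting for the restriction to `R` of an `R[G]`-module. -/
lemma hasProjectiveDimensionLE_restrictScalars_X₁ [Monoid G] {S : ShortComplex (ModuleCat.{u} R[G])}
    (hS : S.ShortExact) [Projective S.X₂] {n : ℕ}
    (h : HasProjectiveDimensionLE
      ((ModuleCat.restrictScalars (singleOneRingHom : R →+* R[G])).obj S.X₃) (n + 1)) :
    HasProjectiveDimensionLE
      ((ModuleCat.restrictScalars (singleOneRingHom : R →+* R[G])).obj S.X₁) n := by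
  let F := ModuleCat.restrictScalars (singleOneRingHom : R →+* R[G])
  have hP : Module.Projective R[G] S.X₂ := (IsProjective.iff_projective _).mpr inferInstance
  have : Module.Projective R[G] (F.obj S.X₂) := hP
  have : Module.Projective R (F.obj S.X₂) := projective_restrictScalars (G := G)
  have hFS : (S.map F).ShortExact :=
    { exact := (ShortComplex.moduleCat_exact_iff (S.map F)).mpr
        ((ShortComplex.moduleCat_exact_iff S).mp hS.exact)
      mono_f := (ModuleCat.mono_iff_injective (S.map F).f).mpr
        ((ModuleCat.mono_iff_injective S.f).mp hS.mono_f)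
      epi_g := (ModuleCat.epi_iff_surjective (S.map F).g).mpr
        ((ModuleCat.epi_iff_surjective S.g).mp hS.epi_g) }
  exact (hFS.hasProjectiveDimensionLT_X₃_iff n
    ((IsProjective.iff_projective (F.obj S.X₂)).mp this)).mp h

/-- Over `R[G]` with `G` finite, a module of finite projective dimension that is projective over
`R` is projective. -/
lemma projective_of_hasProjectiveDimensionLE [Group G] [Finite G] {m : ℕ} {M : ModuleCat.{u} R[G]}
    (hM : HasProjectiveDimensionLE M m)
    (h : Projective ((ModuleCat.restrictScalars (singleOneRingHom : R →+* R[G])).obj M)) :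
    Projective M := by
  let F := ModuleCat.restrictScalars (singleOneRingHom : R →+* R[G])
  induction m generalizing M with
  | zero => exact (projective_iff_hasProjectiveDimensionLE_zero _).mpr hM
  | succ m ih =>
    let S := M.projectiveShortComplex
    have hS : S.ShortExact := M.shortExact_projectiveShortComplex
    have hS₂ : Projective S.X₂ := inferInstanceAs (Projective M.projectiveShortComplex.X₂)
    have hFS₁ : Projective (F.obj S.X₁) :=
      (projective_iff_hasProjectiveDimensionLE_zero _).mpr
        (hasProjectiveDimensionLE_restrictScalars_X₁ hS
          (inferInstanceAs (HasProjectiveDimensionLT (F.obj M) (1 + 1))))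
    have hS₁ : Projective S.X₁ := ih ((hS.hasProjectiveDimensionLT_X₃_iff m hS₂).mp hM) hFS₁
    have hK : Module.Projective R[G] S.X₁ := (IsProjective.iff_projective _).mpr hS₁
    have hP : Module.Projective R[G] S.X₂ := (IsProjective.iff_projective _).mpr hS₂
    let (N : ModuleCat.{u} R[G]) : Module R N := Module.compHom N (singleOneRingHom : R →+* R[G])
    have (N : ModuleCat.{u} R[G]) : IsScalarTower R R[G] N := isScalarTower_compHom N
    have hR : Module.Projective R M := (IsProjective.iff_projective (F.obj M)).mpr h
    refine (IsProjective.iff_projective M).mp ?_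
    exact projective_of_exact (R := R) (M := M) (f := S.f.hom) (g := S.g.hom)
      ((ModuleCat.mono_iff_injective S.f).mp hS.mono_f)
      ((ModuleCat.epi_iff_surjective S.g).mp hS.epi_g)
      ((ShortComplex.ShortExact.moduleCat_exact_iff_function_exact S).mp hS.exact)

/-- Over `R[G]` with `G` finite, a module of finite projective dimension has projective dimension
at most that of its restriction to `R`. -/
lemma hasProjectiveDimensionLE_of_restrictScalars [Group G] [Finite G] {m n : ℕ}
    {M : ModuleCat.{u} R[G]} (hM : HasProjectiveDimensionLE M m)
    (h : HasProjectiveDimensionLE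
      ((ModuleCat.restrictScalars (singleOneRingHom : R →+* R[G])).obj M) n) :
    HasProjectiveDimensionLE M n := by
  induction n generalizing M with
  | zero =>
    rw [← projective_iff_hasProjectiveDimensionLE_zero] at h ⊢
    exact projective_of_hasProjectiveDimensionLE hM h
  | succ n ih =>
    let S := M.projectiveShortComplex
    have hS : S.ShortExact := M.shortExact_projectiveShortComplex
    have hS₂ : Projective S.X₂ := inferInstanceAs (Projective M.projectiveShortComplex.X₂)
    refine (hS.hasProjectiveDimensionLT_X₃_iff n hS₂).mpr (ih ?_
      (hasProjectiveDimensionLE_restrictScalars_X₁ hS h))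
    exact (hS.hasProjectiveDimensionLT_X₃_iff m hS₂).mp (hasProjectiveDimensionLT_of_ge M (m + 1) _
      (by lia))

end MonoidAlgebra

/-- If every `R`-module has projective dimension `≤ n` and `G` is a finite
group, then every `R[G]`-module of finite projective dimension has projective
dimension at most `n` over `R[G]`. -/
theorem pdLE_of_finite_pd (R : Type u) [Ring R] (n : ℕ)
    (hR : ∀ M : ModuleCat.{u} R, pdLE R n M)
    (G : Type u) [Group G] [Finite G]
    (M : ModuleCat.{u} (MonoidAlgebra R G))
    (hM : ∃ m : ℕ, pdLE (MonoidAlgebra R G) m M) :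
    pdLE (MonoidAlgebra R G) n M := by
  obtain ⟨m, hm⟩ := hM
  exact pdLE_iff_hasProjectiveDimensionLE.mpr
    (MonoidAlgebra.hasProjectiveDimensionLE_of_restrictScalars
      (pdLE_iff_hasProjectiveDimensionLE.mp hm) (pdLE_iff_hasProjectiveDimensionLE.mp (hR _)))
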